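/- Let S_A and S_B be types, let A = S_A →₀ ℤ and B = S_B →₀ ℤ be the free abelian groups (finitely supported functions to ℤ) on these bases, let C be a torsion-free abelian group, and let d₁ : A → B, d₂ : B → C be group homomorphisms with d₂ ∘ d₁ = 0. Let 𝒷 ⊆ S_B be a finite subset and define φ : B → ℤ by φ(x) = Σ_{b ∈ 𝒷} x(b). Suppose X ∈ A and V ∈ B satisfy d₁(X) = 2·V, that φ(V) is odd, and that for every basis element s ∈ S_A the integer φ(d₁(δ_s)) is even, where δ_s ∈ A is the basis vector supported at s with value 1. Then V ∈ ker(d₂) and the class of V in the quotient ker(d₂) / im(d₁) has order exactly 2. -/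

import Mathlib

/-- A homomorphism out of a free abelian group that is even on the basis vectors is even. -/
theorem Finsupp.even_of_even_single {S : Type*} (f : (S →₀ ℤ) →+ ℤ)
    (hf : ∀ s, Even (f (Finsupp.single s 1))) (a : S →₀ ℤ) : Even (f a) := by
  induction a using Finsupp.induction_linear with
  | zero => simp
  | add x y hx hy => rw [map_add]; exact hx.add hy
  | single s n =>
    have h : Finsupp.single s n = n • Finsupp.single s (1 : ℤ) := by simp
    rw [h, map_zsmul, smul_eq_mul]
    exact (hf s).mul_left n

/-- the paper's torsion-detection method on free abelian groups.
`A = S_A →₀ ℤ`, `B = S_B →₀ ℤ`, `φ x = Σ_{b ∈ 𝒷} x b`; evenness of `φ ∘ d₁`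
is checked only on the basis vectors `δ_s = Finsupp.single s 1`. -/
theorem stmt_3 {S_A S_B : Type*} {C : Type*} [AddCommGroup C]
    (htf : ∀ (n : ℤ) (x : C), n ≠ 0 → n • x = 0 → x = 0)
    (d₁ : (S_A →₀ ℤ) →+ (S_B →₀ ℤ)) (d₂ : (S_B →₀ ℤ) →+ C)
    (hdd : ∀ a : S_A →₀ ℤ, d₂ (d₁ a) = 0)
    (𝒷 : Finset S_B)
    (X : S_A →₀ ℤ) (V : S_B →₀ ℤ) (hXV : d₁ X = 2 • V)
    (hV : Odd (∑ b ∈ 𝒷, V b))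
    (hd : ∀ s : S_A, Even (∑ b ∈ 𝒷, d₁ (Finsupp.single s 1) b)) :
    ∃ hV' : V ∈ d₂.ker,
      (QuotientAddGroup.mk ⟨V, hV'⟩ :
          d₂.ker ⧸ (d₁.range.addSubgroupOf d₂.ker)) ≠ 0 ∧
      2 • (QuotientAddGroup.mk ⟨V, hV'⟩ :
          d₂.ker ⧸ (d₁.range.addSubgroupOf d₂.ker)) = 0 := by
  have hker : V ∈ d₂.ker := by
    refine htf 2 _ two_ne_zero ?_
    have h := hdd X
    rw [hXV, map_nsmul] at h
    exact_mod_cast h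
  refine ⟨hker, ?_, ?_⟩
  · intro h
    rw [QuotientAddGroup.eq_zero_iff, AddSubgroup.mem_addSubgroupOf] at h
    obtain ⟨a, ha⟩ := h
    let φ : (S_B →₀ ℤ) →+ ℤ := ∑ b ∈ 𝒷, Finsupp.applyAddHom b
    have hφ : ∀ x, φ x = ∑ b ∈ 𝒷, x b := fun x => by simp [φ]
    have hEven : Even ((φ.comp d₁) a) :=
      Finsupp.even_of_even_single _ (fun s => by simpa [hφ] using hd s) a
    rw [AddMonoidHom.comp_apply, ha, hφ] at hEven
    exact Int.not_even_iff_odd.mpr hV hEven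
  · rw [← QuotientAddGroup.mk_nsmul, QuotientAddGroup.eq_zero_iff,
      AddSubgroup.mem_addSubgroupOf]
    exact ⟨X, hXV⟩
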